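/- Let v ∈ ℝ² with v ≠ 0 and let θ ∈ ℝ² be a unit vector with |⟨θ, v⟩| < ‖v‖. Then the improper integral ∫₀^∞ cos(k⟨θ, v⟩) J₀(k‖v‖) dk converges and equals 1 / ( ‖v‖ √( 1 − (⟨θ, v⟩/‖v‖)² ) ). -/

import Mathlib

open Real Filter Topology

/-- Bessel function of the first kind of order zero. -/
noncomputable def J0 (x : ℝ) : ℝ := (1 / π) * ∫ t in (0:ℝ)..π, Real.cos (x * Real.sin t)

/-- Euclidean inner product on ℝ². -/
def dot (u v : ℝ × ℝ) : ℝ := u.1 * v.1 + u.2 * v.2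

/-- Euclidean norm on ℝ². -/
noncomputable def enorm2 (v : ℝ × ℝ) : ℝ := Real.sqrt (v.1 ^ 2 + v.2 ^ 2)

open MeasureTheory Set in
theorem aux_RL (q : ℝ → ℝ) (hq : Integrable q) :
    Tendsto (fun T : ℝ => ∫ u, Real.sin (T * u) * q u) atTop (𝓝 0) := by
  have h1 := Real.tendsto_integral_exp_smul_cocompact (fun u => (q u : ℂ))
  have h2 : Tendsto (fun T : ℝ => -T / (2 * π)) atTop (cocompact ℝ) := by
    have : Tendsto (fun T : ℝ => -T / (2 * π)) atTop atBot :=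
      tendsto_neg_atTop_atBot.atBot_div_const (by positivity)
    exact this.mono_right atBot_le_cocompact
  have h3 := (Complex.continuous_im.tendsto 0).comp (h1.comp h2)
  refine h3.congr ?_
  intro T
  have key : ∀ u : ℝ, Real.fourierChar (-(u * (-T / (2 * π)))) • (q u : ℂ)
      = Complex.exp ((T * u : ℝ) * Complex.I) * (q u : ℂ) := by
    intro u
    rw [Circle.smul_def, Real.fourierChar_apply, smul_eq_mul]
    congr 4
    field_simp
  simp only [Function.comp, key]
  have hint : Integrable (fun u : ℝ => Complex.exp ((T * u : ℝ) * Complex.I) * (q u : ℂ)) := by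
    apply Integrable.bdd_mul (c := 1) hq.ofReal
    · exact Continuous.aestronglyMeasurable (by fun_prop)
    · refine Eventually.of_forall fun u => ?_
      rw [Complex.norm_exp_ofReal_mul_I]
  have := Complex.imCLM.integral_comp_comm hint
  simp only [Complex.imCLM_apply] at this
  rw [← this]
  refine integral_congr_ae (Eventually.of_forall fun u => ?_)
  simp only [Complex.im_mul_ofReal, Complex.exp_ofReal_mul_I_im]

open MeasureTheory Set in
theorem aux_q (φ : ℝ → ℝ) (hφ : Integrable φ) (h0 : φ 0 = 0) (hd : DifferentiableAt ℝ φ 0) :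
    Integrable (fun u => φ u / u) := by
  have hO := hd.hasDerivAt.isBigO_sub
  simp only [h0, sub_zero] at hO
  obtain ⟨C, hC⟩ := hO.bound
  obtain ⟨δ, hδ, hb⟩ := Metric.eventually_nhds_iff.1 hC
  have hm : AEStronglyMeasurable (fun u => φ u / u) volume :=
    (hφ.aemeasurable.div aemeasurable_id).aestronglyMeasurable
  have hi : Integrable (fun u => (Ioo (-δ) δ).indicator (fun _ => |C|) u + (1/δ) * ‖φ u‖) := by
    refine Integrable.add ?_ (hφ.norm.const_mul _)
    rw [integrable_indicator_iff measurableSet_Ioo]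
    exact integrableOn_const (by simp)
  refine hi.mono' hm (Eventually.of_forall fun u => ?_)
  rw [norm_div]
  by_cases hu : u ∈ Ioo (-δ) δ
  · rw [indicator_of_mem hu]
    have h1 := hb (y := u) (by rw [Real.dist_eq, sub_zero, abs_lt]; exact hu)
    have h2 : 0 ≤ (1/δ) * ‖φ u‖ := by positivity
    have h3 : ‖φ u‖ / ‖u‖ ≤ |C| := by
      apply div_le_of_le_mul₀ (norm_nonneg _) (abs_nonneg _)
      exact h1.trans (mul_le_mul_of_nonneg_right (le_abs_self C) (norm_nonneg _))
    linarith
  · rw [indicator_of_notMem hu, zero_add, div_eq_mul_inv, mul_comm, one_div]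
    have : δ ≤ ‖u‖ := by
      rw [Real.norm_eq_abs]; by_contra hh; push Not at hh; exact hu (abs_lt.1 hh)
    gcongr

open MeasureTheory Set in
theorem aux_cosint (φ : ℝ → ℝ) (hφ : Integrable φ) (k : ℝ) :
    Integrable (fun u => Real.cos (k * u) * φ u) := by
  apply Integrable.bdd_mul (c := 1) hφ
  · exact Continuous.aestronglyMeasurable (by fun_prop)
  · exact Eventually.of_forall fun u => by simpa using Real.abs_cos_le_one _

open MeasureTheory Set in
theorem aux_cont (φ : ℝ → ℝ) (hφ : Integrable φ) :
    Continuous (fun k => ∫ u, Real.cos (k * u) * φ u) := by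
  refine continuous_of_dominated (bound := fun u => ‖φ u‖) ?_ ?_ hφ.norm ?_
  · intro k; exact (aux_cosint φ hφ k).aestronglyMeasurable
  · intro k
    refine Eventually.of_forall fun u => ?_
    rw [norm_mul]
    exact mul_le_of_le_one_left (norm_nonneg _) (by simpa using Real.abs_cos_le_one _)
  · refine Eventually.of_forall fun u => ?_
    fun_prop

open MeasureTheory Set in
theorem aux_zero (φ : ℝ → ℝ) (hφ : Integrable φ) (h0 : φ 0 = 0) (hd : DifferentiableAt ℝ φ 0) :
    Tendsto (fun T : ℝ => ∫ k in (0:ℝ)..T, ∫ u, Real.cos (k * u) * φ u) atTop (𝓝 0) := by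
  refine (aux_RL _ (aux_q φ hφ h0 hd)).congr ?_
  intro T
  rw [intervalIntegral_integral_swap]
  · refine integral_congr_ae (Eventually.of_forall fun u => ?_)
    simp only
    rw [intervalIntegral.integral_mul_const]
    by_cases hu : u = 0
    · simp [hu, h0]
    · rw [intervalIntegral.integral_comp_mul_right (fun x => Real.cos x) hu, integral_cos]
      simp; field_simp
  · have h1 : Integrable (fun z : ℝ × ℝ => (1:ℝ) * φ z.2)
        ((volume.restrict (Set.uIoc 0 T)).prod volume) :=
      Integrable.mul_prod (f := fun _ : ℝ => (1:ℝ)) (integrableOn_const (by simp [Set.uIoc])) hφ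
    simp only [one_mul] at h1
    apply Integrable.bdd_mul (c := 1) h1 (f := fun z : ℝ × ℝ => Real.cos (z.1 * z.2))
    · exact Continuous.aestronglyMeasurable (by fun_prop)
    · exact Eventually.of_forall fun u => by simpa using Real.abs_cos_le_one _

open MeasureTheory Set in
theorem aux_gauss_ft (k : ℝ) :
    ∫ u : ℝ, Real.cos (k * u) * Real.exp (-1 * u ^ 2) = √π * Real.exp (-(1/4) * k ^ 2) := by
  have h := fourierIntegral_gaussian (b := 1) (by simp) (k : ℂ)
  have hint : Integrable (fun u : ℝ => Complex.exp (Complex.I * k * u) *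
      Complex.exp (-1 * (u:ℂ) ^ 2)) := by
    have : Integrable (fun u : ℝ => ((Real.exp (-1 * u ^ 2) : ℝ) : ℂ)) :=
      (integrable_exp_neg_mul_sq one_pos).ofReal
    simp only [Complex.ofReal_exp] at this
    push_cast at this
    apply Integrable.bdd_mul (c := 1) this
    · exact Continuous.aestronglyMeasurable (by fun_prop)
    · refine Eventually.of_forall fun u => ?_
      have : Complex.I * k * u = ((k * u : ℝ) : ℂ) * Complex.I := by push_cast; ring
      rw [this, Complex.norm_exp_ofReal_mul_I]
  have h2 := Complex.reCLM.integral_comp_comm hint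
  rw [h] at h2
  simp only [Complex.reCLM_apply] at h2
  have e1 : ((π / 1 : ℂ) ^ (1 / 2 : ℂ) * Complex.exp (-(k:ℂ) ^ 2 / (4 * 1)))
      = ((√π * Real.exp (-(1/4) * k ^ 2) : ℝ) : ℂ) := by
    rw [Real.sqrt_eq_rpow]
    push_cast
    rw [Complex.ofReal_cpow pi_pos.le]
    push_cast
    rw [div_one]
    congr 2
    ring
  rw [e1, Complex.ofReal_re] at h2
  rw [← h2]
  refine integral_congr_ae (Eventually.of_forall fun u => ?_)
  have e2 : Complex.I * k * u = ((k * u : ℝ) : ℂ) * Complex.I := by push_cast; ring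
  have e3 : Complex.exp (-1 * (u:ℂ) ^ 2) = ((Real.exp (-1 * u ^ 2) : ℝ) : ℂ) := by push_cast; rfl
  simp only [e2, e3, Complex.re_mul_ofReal, Complex.exp_ofReal_mul_I_re]

open MeasureTheory Set in
theorem aux_gauss :
    Tendsto (fun T : ℝ => ∫ k in (0:ℝ)..T, ∫ u, Real.cos (k * u) * Real.exp (-1 * u ^ 2))
      atTop (𝓝 π) := by
  simp only [aux_gauss_ft, intervalIntegral.integral_const_mul]
  have h := intervalIntegral_tendsto_integral_Ioi (μ := volume) 0
    (integrable_exp_neg_mul_sq (b := 1/4) (by norm_num)).integrableOn tendsto_id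
  rw [integral_gaussian_Ioi] at h
  have h2 := h.const_mul √π
  have : √π * (√(π / (1/4)) / 2) = π := by
    have : π / (1/4) = π * 2 ^ 2 := by ring
    rw [this, Real.sqrt_mul pi_pos.le, Real.sqrt_sq (by norm_num)]
    have := Real.mul_self_sqrt pi_pos.le
    linarith
  rw [this] at h2
  exact h2

open MeasureTheory Set in
/-- Pointwise Fourier inversion at `0`. -/
theorem aux_inv (w : ℝ → ℝ) (hw : Integrable w) (hd : DifferentiableAt ℝ w 0) :
    Tendsto (fun T : ℝ => ∫ k in (0:ℝ)..T, ∫ u, Real.cos (k * u) * w u) atTop (𝓝 (π * w 0)) := by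
  have hg : Integrable (fun u : ℝ => Real.exp (-1 * u ^ 2)) := integrable_exp_neg_mul_sq one_pos
  have h1 := aux_zero (fun u => w u - w 0 * Real.exp (-1 * u ^ 2)) (hw.sub (hg.const_mul _))
    (by simp) (hd.sub (by fun_prop))
  have h2 := h1.add (aux_gauss.const_mul (w 0))
  rw [zero_add, mul_comm] at h2
  refine h2.congr ?_
  intro T
  have hc := aux_cont w hw
  have hc' := aux_cont _ hg
  rw [← intervalIntegral.integral_const_mul, ← intervalIntegral.integral_add]
  · congr 1
    ext k
    rw [← integral_const_mul, ← integral_add]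
    · congr 1; ext u; ring
    · exact aux_cosint _ (hw.sub (hg.const_mul _)) k
    · exact (aux_cosint _ hg k).const_mul _
  · exact (aux_cont _ (hw.sub (hg.const_mul _))).intervalIntegrable _ _
  · exact (hc'.const_mul _).intervalIntegrable _ _

theorem aux_J0 (a r k : ℝ) :
    Real.cos (k * a) * J0 (k * r) = (1/π) * ∫ t in (0:ℝ)..π, Real.cos (k * (a - r * Real.cos t)) := by
  have hper : Function.Periodic (fun t => Real.cos (k * r * Real.sin t)) π := by
    intro t; simp [Real.sin_add_pi]
  have h1 : ∫ t in (0:ℝ)..π, Real.cos (k * r * Real.sin t)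
      = ∫ t in (0:ℝ)..π, Real.cos (k * r * Real.cos t) := by
    have e1 := hper.intervalIntegral_add_eq 0 (π/2)
    have e2 := intervalIntegral.integral_comp_add_right (a := 0) (b := π)
      (fun t => Real.cos (k * r * Real.sin t)) (π/2)
    simp only [Real.sin_add_pi_div_two] at e2
    rw [zero_add] at e1 e2
    rw [e1, e2, add_comm]
  have h2 : ∫ t in (0:ℝ)..π, Real.sin (k * r * Real.cos t) = 0 := by
    have e2 := intervalIntegral.integral_comp_sub_left (a := 0) (b := π)
      (fun t => Real.sin (k * r * Real.cos t)) π
    simp only [Real.cos_pi_sub, mul_neg, Real.sin_neg, intervalIntegral.integral_neg, sub_self,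
      sub_zero] at e2
    linarith
  have h3 : ∀ t, Real.cos (k * (a - r * Real.cos t)) = Real.cos (k*a) * Real.cos (k * r * Real.cos t)
      + Real.sin (k*a) * Real.sin (k * r * Real.cos t) := by
    intro t; rw [← Real.cos_sub]; congr 1; ring
  simp only [h3]
  rw [intervalIntegral.integral_add, intervalIntegral.integral_const_mul,
    intervalIntegral.integral_const_mul, h2, J0, h1]
  · ring
  · exact Continuous.intervalIntegrable (by fun_prop) _ _
  · exact Continuous.intervalIntegrable (by fun_prop) _ _

open MeasureTheory Set in
theorem aux_subst (a r : ℝ) (hr : 0 < r) :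
    Integrable (fun u => 1 / √(r ^ 2 - (u - a) ^ 2)) ∧
    ∀ k : ℝ, ∫ t in (0:ℝ)..π, Real.cos (k * (a - r * Real.cos t))
      = ∫ u, Real.cos (k * u) * (1 / √(r ^ 2 - (u - a) ^ 2)) := by
  have hder : ∀ t ∈ Ioo 0 π, HasDerivWithinAt (fun t => a - r * Real.cos t) (r * Real.sin t)
      (Ioo 0 π) t := by
    intro t _
    have := ((Real.hasDerivAt_cos t).const_mul r).const_sub a
    have e : -(r * -Real.sin t) = r * Real.sin t := by ring
    rw [e] at this
    exact this.hasDerivWithinAt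
  have hinj : InjOn (fun t => a - r * Real.cos t) (Ioo 0 π) := by
    intro s hs t ht hst
    refine Real.injOn_cos (Ioo_subset_Icc_self hs) (Ioo_subset_Icc_self ht) ?_
    have : r * (Real.cos s - Real.cos t) = 0 := by simp only at hst; linarith
    rcases mul_eq_zero.1 this with h | h
    · exact absurd h hr.ne'
    · linarith
  have hval : ∀ t ∈ Ioo 0 π,
      |r * Real.sin t| * (1 / √(r ^ 2 - ((a - r * Real.cos t) - a) ^ 2)) = 1 := by
    intro t ht
    have hs := Real.sin_pos_of_mem_Ioo ht
    have : r ^ 2 - ((a - r * Real.cos t) - a) ^ 2 = (r * Real.sin t) ^ 2 := by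
      have := Real.sin_sq_add_cos_sq t
      linear_combination (-r^2) * this
    rw [this, Real.sqrt_sq_eq_abs, mul_one_div, div_self]
    exact abs_ne_zero.2 (by positivity)
  have hout : ∀ u, u ∉ (fun t => a - r * Real.cos t) '' Ioo 0 π →
      1 / √(r ^ 2 - (u - a) ^ 2) = 0 := by
    intro u hu
    rcases le_or_gt (r ^ 2 - (u - a) ^ 2) 0 with h | h
    · rw [Real.sqrt_eq_zero_of_nonpos h]; simp
    · exfalso; apply hu
      have h1 : |u - a| < r := abs_lt_of_sq_lt_sq (by linarith) hr.le
      obtain ⟨h2, h3⟩ := abs_lt.1 h1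
      refine ⟨Real.arccos ((a - u) / r), ⟨?_, ?_⟩, ?_⟩
      · rw [Real.arccos_pos, div_lt_one hr]; linarith
      · refine lt_of_le_of_ne (Real.arccos_le_pi _) fun he => ?_
        rw [Real.arccos_eq_pi, div_le_iff₀ hr] at he
        linarith
      · simp only
        rw [Real.cos_arccos]
        · field_simp; ring
        · rw [le_div_iff₀ hr]; linarith
        · rw [div_le_iff₀ hr]; linarith
  have hmeas : MeasurableSet ((fun t => a - r * Real.cos t) '' Ioo 0 π) := 
    measurableSet_Ioo.image_of_continuousOn_injOn (by fun_prop) hinj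
  constructor
  · rw [← integrableOn_iff_integrable_of_support_subset
      (s := (fun t => a - r * Real.cos t) '' Ioo 0 π)]
    · rw [integrableOn_image_iff_integrableOn_abs_deriv_smul measurableSet_Ioo hder hinj]
      refine (integrableOn_const (s := Ioo 0 π) (C := (1:ℝ)) (by simp)).congr_fun ?_
        measurableSet_Ioo
      intro t ht
      exact (hval t ht).symm
    · intro u hu
      by_contra h
      exact hu (hout u h)
  · intro k
    rw [← setIntegral_eq_integral_of_forall_compl_eq_zero
      (s := (fun t => a - r * Real.cos t) '' Ioo 0 π)]
    · rw [integral_image_eq_integral_abs_deriv_smul measurableSet_Ioo hder hinj,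
        intervalIntegral.integral_of_le pi_pos.le, integral_Ioc_eq_integral_Ioo]
      refine setIntegral_congr_fun measurableSet_Ioo ?_
      intro t ht
      have := hval t ht
      simp only [smul_eq_mul]
      linear_combination (-Real.cos (k * (a - r * Real.cos t))) * this
    · intro u hu
      rw [hout u hu, mul_zero]

/-- For `v ≠ 0` and a unit vector `θ` with `|⟨θ,v⟩| < ‖v‖`, the improper
integral `∫₀^∞ cos(k⟨θ,v⟩) J₀(k‖v‖) dk` converges and equals
`1/(‖v‖ √(1 − (⟨θ,v⟩/‖v‖)²))`. -/
theorem stmt_13 (v θ : ℝ × ℝ) (hv : v ≠ 0) (hθ : enorm2 θ = 1)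
    (h : |dot θ v| < enorm2 v) :
    Tendsto (fun T : ℝ => ∫ k in (0:ℝ)..T, Real.cos (k * dot θ v) * J0 (k * enorm2 v))
      atTop (𝓝 (1 / (enorm2 v * Real.sqrt (1 - (dot θ v / enorm2 v) ^ 2)))) := by
  have hr : 0 < enorm2 v := (abs_nonneg _).trans_lt h
  generalize enorm2 v = r at *
  generalize dot θ v = a at *
  obtain ⟨hI, hS⟩ := aux_subst a r hr
  have hpos : 0 < r ^ 2 - a ^ 2 := by
    have := sq_lt_sq' (abs_lt.1 h).1 (abs_lt.1 h).2
    linarith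
  have hd : DifferentiableAt ℝ (fun u => 1 / √(r ^ 2 - (u - a) ^ 2)) 0 := by
    have h0 : r ^ 2 - (0 - a) ^ 2 ≠ 0 := by
      rw [zero_sub, neg_sq]; exact hpos.ne'
    have h1 : DifferentiableAt ℝ (fun u : ℝ => r ^ 2 - (u - a) ^ 2) 0 := by fun_prop
    refine (differentiableAt_const _).div (h1.sqrt h0) ?_
    rw [zero_sub, neg_sq]
    exact (Real.sqrt_pos.2 hpos).ne'
  have hl := (aux_inv _ hI hd).const_mul (1/π)
  have e : 1/π * (π * (1 / √(r ^ 2 - (0 - a) ^ 2))) = 1 / (r * √(1 - (a / r) ^ 2)) := by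
    have : r ^ 2 - (0 - a) ^ 2 = r ^ 2 * (1 - (a / r) ^ 2) := by field_simp; ring
    rw [this, Real.sqrt_mul (by positivity), Real.sqrt_sq hr.le]
    field_simp
  rw [e] at hl
  refine hl.congr ?_
  intro T
  rw [← intervalIntegral.integral_const_mul]
  congr 1
  ext k
  rw [aux_J0, hS]
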